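/- Let ν : H² → ℂ be a bounded linear functional such that ν(g) ≠ 0 for every shifted outer function g ∈ H². Then there exist z₀ ∈ 𝔻 \ {0} and σ ∈ ℂ \ {0} such that ν(f) = σ·f(z₀) for all f ∈ H². -/

import Mathlib

open Metric

/-- The set of right-shifted copies of a sequence `a ∈ ℓ²(ℤ₊)`. -/
def shiftOrbit (a : lp (fun _ : ℕ => ℂ) 2) : Set (lp (fun _ : ℕ => ℂ) 2) :=
  {f | ∃ m : ℕ, ∀ n : ℕ, f n = if n < m then 0 else a (n - m)}

/-- Outer functions in H², identified with their ℓ² coefficient sequences. -/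
def OuterSeq (a : lp (fun _ : ℕ => ℂ) 2) : Prop :=
  Dense ((Submodule.span ℂ (shiftOrbit a) : Submodule ℂ (lp (fun _ : ℕ => ℂ) 2)) :
    Set (lp (fun _ : ℕ => ℂ) 2))

/-- Shifted outer functions: right shifts of outer functions. -/
def ShiftedOuterSeq (a : lp (fun _ : ℕ => ℂ) 2) : Prop :=
  ∃ (m : ℕ) (b : lp (fun _ : ℕ => ℂ) 2), OuterSeq b ∧
    ∀ n : ℕ, a n = if n < m then 0 else b (n - m)

namespace Stmt12

abbrev H : Type := lp (fun _ : ℕ => ℂ) 2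

/-- A non-vanishing entire function of exponential type satisfies `F' = β F`. -/
theorem entire_exp (F : ℂ → ℂ) (hF : Differentiable ℂ F) (h0 : ∀ w, F w ≠ 0)
    (C K : ℝ) (hK : 0 ≤ K) (hb : ∀ w, ‖F w‖ ≤ C * Real.exp (K * ‖w‖)) :
    ∃ β : ℂ, ∀ w, deriv F w = β * F w := by
  have hF' : Differentiable ℂ (deriv F) := by
    intro z
    exact (hF.analyticAt z).deriv.differentiableAt
  have hL : Differentiable ℂ (fun w => deriv F w / F w) := hF'.div hF h0
  have hex := Complex.IsConservativeOn.isExactOn_univ hL.continuous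
    hL.differentiableOn.isConservativeOn
  obtain ⟨g, hg0, hg⟩ := hex.with_val_at 0 0
  have hg : ∀ x, HasDerivAt g (deriv F x / F x) x := fun x => hg x (Set.mem_univ x)
  have hgd : Differentiable ℂ g := fun x => (hg x).differentiableAt
  have hconst : ∀ w, F w * Complex.exp (-g w) = F 0 := by
    intro w
    have hd : ∀ x, HasDerivAt (fun w => F w * Complex.exp (-g w)) 0 x := by
      intro x
      have h1 := (hF x).hasDerivAt.mul ((hg x).neg.cexp)
      convert! h1 using 1
      have := h0 x
      simp only [Pi.neg_apply]
      field_simp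
      ring
    have := is_const_of_deriv_eq_zero (fun x => (hd x).differentiableAt) (fun x => (hd x).deriv) w 0
    simpa [hg0] using this
  have hFg : ∀ w, F w = F 0 * Complex.exp (g w) := by
    intro w
    rw [← hconst w, mul_assoc, ← Complex.exp_add]
    simp
  have hCpos : 0 < C := by
    have := hb 0
    simp at this
    exact (norm_pos_iff.mpr (h0 0)).trans_le this
  have hF0 := norm_pos_iff.mpr (h0 0)
  set B := |Real.log (C / ‖F 0‖)| + 1 with hB
  have hBpos : 0 < B := by positivity
  have hre : ∀ w, (g w).re ≤ B + K * ‖w‖ := by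
    intro w
    have h1 := hb w
    rw [hFg w, norm_mul, Complex.norm_exp] at h1
    have h2 : Real.exp (g w).re ≤ (C / ‖F 0‖) * Real.exp (K * ‖w‖) := by
      rw [div_mul_eq_mul_div, le_div_iff₀ hF0]; linarith
    have h3 : (C / ‖F 0‖) * Real.exp (K * ‖w‖) =
        Real.exp (Real.log (C / ‖F 0‖) + K * ‖w‖) := by
      rw [Real.exp_add, Real.exp_log (by positivity)]
    rw [h3, Real.exp_le_exp] at h2
    have := le_abs_self (Real.log (C / ‖F 0‖))
    linarith
  have hgb : ∀ z, ‖g z‖ ≤ 2 * (B + K * (2 * (‖z‖ + 1))) := by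
    intro z
    have hz := norm_nonneg z
    have h1 := Complex.borelCaratheodory_zero (f := g) (z := z) (R := 2 * (‖z‖ + 1))
      (M := B + K * (2 * (‖z‖ + 1))) (by positivity) hgd.differentiableOn
      (by
        intro w hw
        have hw' : ‖w‖ < 2 * (‖z‖ + 1) := mem_ball_zero_iff.mp hw
        have := hre w
        change (g w).re ≤ _
        nlinarith) (by positivity) (mem_ball_zero_iff.mpr (by linarith)) hg0
    refine h1.trans ?_
    have hM : 0 ≤ 2 * (B + K * (2 * (‖z‖ + 1))) := by positivity
    rw [div_le_iff₀ (by linarith)]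
    exact mul_le_mul_of_nonneg_left (by linarith) hM
  have hdb : ∀ z, ‖deriv g z‖ ≤ 2 * B + 8 * K := by
    intro z
    have hz := norm_nonneg z
    have h1 := Complex.norm_deriv_le_of_forall_mem_sphere_norm_le (f := g) (c := z)
      (R := ‖z‖ + 1) (C := 2 * (B + K * (2 * ((2 * ‖z‖ + 1) + 1)))) (by positivity)
      hgd.diffContOnCl (by
        intro w hw
        have h2 : ‖w‖ ≤ 2 * ‖z‖ + 1 := by
          have h3 : ‖w - z‖ = ‖z‖ + 1 := mem_sphere_iff_norm.mp hw
          have h4 := norm_add_le (w - z) z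
          rw [sub_add_cancel] at h4
          linarith
        refine (hgb w).trans ?_
        gcongr)
    refine h1.trans ?_
    rw [div_le_iff₀ (by positivity)]
    nlinarith [mul_nonneg hBpos.le hz]
  have hgd' : Differentiable ℂ (deriv g) := fun z => (hgd.analyticAt z).deriv.differentiableAt
  refine ⟨deriv g 0, fun w => ?_⟩
  have hbd : Bornology.IsBounded (Set.range (deriv g)) := by
    rw [isBounded_iff_forall_norm_le]
    exact ⟨_, by rintro _ ⟨z, rfl⟩; exact hdb z⟩
  rw [hgd'.apply_eq_apply_of_bounded hbd 0 w, (hg w).deriv]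
  have := h0 w
  field_simp

/-- the underlying function of the shift -/
def sfun (a : ℕ → ℂ) : ℕ → ℂ := fun n => if n < 1 then 0 else a (n - 1)

theorem sfun_summable (a : H) : Summable fun n => ‖sfun a n‖ ^ (2 : ENNReal).toReal := by
  rw [← summable_nat_add_iff 1]
  have := (lp.memℓp a).summable (by norm_num)
  simpa [sfun] using this

/-- the shift -/
noncomputable def S : H →L[ℂ] H :=
  LinearMap.mkContinuous
    { toFun := fun a => ⟨sfun a, memℓp_gen (sfun_summable a)⟩
      map_add' := by
        intro a b
        ext n
        simp only [sfun, lp.coeFn_add, Pi.add_apply]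
        split_ifs <;> simp
      map_smul' := by
        intro c a
        ext n
        simp only [sfun, lp.coeFn_smul, Pi.smul_apply, RingHom.id_apply]
        split_ifs <;> simp } 1 (by
    intro a
    refine lp.norm_le_of_tsum_le (by norm_num) (by positivity) ?_
    rw [one_mul, lp.norm_rpow_eq_tsum (by norm_num)]
    change ∑' n, ‖sfun a n‖ ^ (2 : ENNReal).toReal ≤ _
    rw [(sfun_summable a).tsum_eq_zero_add]
    simp [sfun])

theorem S_apply (a : H) (n : ℕ) : S a n = if n < 1 then 0 else a (n - 1) := rfl

theorem S_pow_apply (a : H) (m n : ℕ) : (S ^ m) a n = if n < m then 0 else a (n - m) := by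
  induction m generalizing n with
  | zero => simp
  | succ m ih =>
    rw [pow_succ', mul_apply_eq_comp, S_apply, ih]
    by_cases h1 : n < 1
    · simp [h1]; omega
    · have : n - 1 < m ↔ n < m + 1 := by omega
      simp [h1, this, Nat.sub_sub, add_comm]

/-- basis vector -/
noncomputable def e (n : ℕ) : H := lp.single 2 n (1 : ℂ)

theorem S_pow_e (m : ℕ) : (S ^ m) (e 0) = e m := by
  ext n
  rw [S_pow_apply]
  simp only [e, lp.single_apply, Pi.single_apply]
  by_cases h : n < m
  · simp [h, h.ne]
  · have : n - m = 0 ↔ n = m := by omega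
    simp [h, this]

theorem S_e (m : ℕ) : S (e m) = e (m + 1) := by
  rw [← S_pow_e m, ← S_pow_e (m + 1), pow_succ', mul_apply_eq_comp]

theorem dense_e : Dense ((Submodule.span ℂ (Set.range e) : Submodule ℂ H) : Set H) := by
  intro a
  have h := lp.hasSum_single (p := 2) (by norm_num) a
  refine mem_closure_of_tendsto h (Filter.Eventually.of_forall fun s => ?_)
  refine Submodule.sum_mem _ fun i _ => ?_
  have : lp.single 2 i (a i) = (a i) • e i := by
    rw [e, ← lp.single_smul]; simp
  rw [this]
  exact Submodule.smul_mem _ _ (Submodule.subset_span ⟨i, rfl⟩)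

theorem outer_of_unit (T T' : H →L[ℂ] H) (hT : T * T' = 1) (hc : Commute T S) :
    OuterSeq (T (e 0)) := by
  have hsurj : Function.Surjective T := fun y => ⟨T' y, by
    rw [← mul_apply_eq_comp, hT]; rfl⟩
  have h1 := hsurj.denseRange.dense_image T.continuous dense_e
  refine h1.mono ?_
  rintro _ ⟨x, hx, rfl⟩
  have : (Submodule.span ℂ (Set.range e)).map (T : H →ₗ[ℂ] H) ≤
      Submodule.span ℂ (shiftOrbit (T (e 0))) := by
    rw [Submodule.map_span, Submodule.span_le]
    rintro _ ⟨_, ⟨m, rfl⟩, rfl⟩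
    refine Submodule.subset_span ⟨m, fun n => ?_⟩
    rw [← S_pow_apply, ← mul_apply_eq_comp, ← (hc.pow_right m).eq,
      mul_apply_eq_comp, S_pow_e]
    rfl
  exact this ⟨x, hx, rfl⟩

theorem norm_exp_le (T : H →L[ℂ] H) : ‖NormedSpace.exp T‖ ≤ Real.exp ‖T‖ := by
  have h1 := NormedSpace.exp_series_hasSum_exp' (𝕂 := ℂ) T
  have h2 := NormedSpace.expSeries_div_hasSum_exp (‖T‖ : ℝ)
  rw [← Real.exp_eq_exp_ℝ] at h2
  refine h1.norm_le_of_bounded h2 fun n => ?_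
  rw [norm_smul, norm_inv, Complex.norm_natCast, div_eq_inv_mul]
  gcongr
  rcases n.eq_zero_or_pos with rfl | hn
  · rw [pow_zero, pow_zero]
    exact ContinuousLinearMap.norm_id_le
  · exact norm_pow_le' T hn

theorem main (ν : H →L[ℂ] ℂ) (h : ∀ a : H, ShiftedOuterSeq a → ν a ≠ 0) :
    ∃ z₀ ∈ ball (0:ℂ) 1, z₀ ≠ 0 ∧ ∃ σ : ℂ, σ ≠ 0 ∧
      ∀ a : H, ν a = σ * ∑' n : ℕ, a n * z₀ ^ n := by
  let F : ℕ → ℂ → ℂ := fun m w => ν (NormedSpace.exp (w • S) (e m))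
  have hder : ∀ m w, HasDerivAt (F m) (F (m + 1) w) w := by
    intro m w
    have h1 := hasDerivAt_exp_smul_const (𝕂 := ℂ) S w
    have h2 := h1.clm_apply (hasDerivAt_const w (e m))
    have h3 := ν.hasFDerivAt.comp_hasDerivAt w h2
    simp only [map_zero, add_zero, mul_apply_eq_comp, S_e] at h3
    exact h3
  have houter : ∀ w : ℂ, OuterSeq (NormedSpace.exp (w • S) (e 0)) := by
    intro w
    refine outer_of_unit _ (NormedSpace.exp (-(w • S))) ?_ ?_
    · letI : NormedAlgebra ℚ (H →L[ℂ] H) := NormedAlgebra.restrictScalars ℚ ℂ _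
      rw [← NormedSpace.exp_add_of_commute ((Commute.refl _).neg_right)]
      simp
    · exact (((Commute.refl S).smul_left w).exp_left)
  have hne : ∀ w, F 0 w ≠ 0 := fun w => h _ ⟨0, _, houter w, by simp⟩
  obtain ⟨β, hβ⟩ := entire_exp (F 0) (fun w => (hder 0 w).differentiableAt) hne
    (‖ν‖ * ‖e 0‖) ‖S‖ (norm_nonneg _) (by
      intro w
      have h1 : ‖F 0 w‖ ≤ ‖ν‖ * (‖NormedSpace.exp (w • S)‖ * ‖e 0‖) :=
        (ν.le_opNorm _).trans (by gcongr; exact ContinuousLinearMap.le_opNorm _ _)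
      have h2 := norm_exp_le (w • S)
      rw [norm_smul] at h2
      refine h1.trans ?_
      rw [mul_comm ‖S‖, mul_assoc, mul_comm ‖e 0‖]
      gcongr)
  have hrec : ∀ m w, F (m + 1) w = β * F m w := by
    intro m
    induction m with
    | zero => intro w; rw [← (hder 0 w).deriv, hβ]
    | succ m ih =>
      intro w
      have h1 := (hder m w).const_mul β
      have h2 : (fun w => β * F m w) = F (m + 1) := (funext ih).symm
      rw [h2] at h1
      exact (hder (m + 1) w).unique h1
  have hF0 : ∀ m, F m 0 = ν (e m) := by intro m; simp [F]
  have hc : ∀ m, ν (e m) = ν (e 0) * β ^ m := by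
    intro m
    induction m with
    | zero => simp
    | succ m ih => rw [← hF0, hrec, hF0, ih]; ring
  have hσ : ν (e 0) ≠ 0 := by rw [← hF0]; exact hne 0
  have h1ne : ν (e 1) ≠ 0 := by
    refine h _ ⟨1, e 0, ?_, fun n => ?_⟩
    · simpa using houter 0
    · rw [← S_pow_apply, S_pow_e]
  have hβ0 : β ≠ 0 := by
    rintro rfl
    exact h1ne (by rw [hc]; simp)
  have hsum : ∀ a : H, ν a = ν (e 0) * ∑' n : ℕ, a n * β ^ n := by
    intro a
    have h1 := (lp.hasSum_single (p := 2) (by norm_num) a).mapL ν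
    rw [← h1.tsum_eq, ← tsum_mul_left]
    refine tsum_congr fun n => ?_
    have : lp.single 2 n (a n) = (a n) • e n := by
      rw [e, ← lp.single_smul]; simp
    rw [this, map_smul, hc, smul_eq_mul]; ring
  refine ⟨β, ?_, hβ0, ν (e 0), hσ, hsum⟩
  rw [mem_ball_zero_iff]
  -- Riesz
  set v := (InnerProductSpace.toDual ℂ H).symm ν with hv
  have hvn : ∀ n, ‖v n‖ = ‖ν (e 0)‖ * ‖β‖ ^ n := by
    intro n
    have h1 : inner ℂ v (e n) = ν (e n) := InnerProductSpace.toDual_symm_apply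
    rw [e, lp.inner_single_right, ← e, hc] at h1
    have h2 := congrArg norm h1
    simpa using h2
  have ht := ((lp.memℓp v).summable (by norm_num)).tendsto_atTop_zero
  by_contra hcon
  push Not at hcon
  have hpos : 0 < ‖ν (e 0)‖ := norm_pos_iff.mpr hσ
  have hle : ‖ν (e 0)‖ ^ 2 ≤ 0 := by
    refine ge_of_tendsto' ht fun n => ?_
    rw [hvn]
    have : 1 ≤ ‖β‖ ^ n := one_le_pow₀ hcon
    simp only [ENNReal.toReal_ofNat, Real.rpow_ofNat]
    gcongr
    nlinarith
  have : 0 < ‖ν (e 0)‖ ^ 2 := by positivity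
  linarith

end Stmt12

/-- A bounded linear functional on H² that is non-vanishing on shifted outer functions
is a non-zero multiple of evaluation at a non-zero point of the open unit disk. -/
theorem stmt_12 (ν : lp (fun _ : ℕ => ℂ) 2 →L[ℂ] ℂ)
    (h : ∀ a : lp (fun _ : ℕ => ℂ) 2, ShiftedOuterSeq a → ν a ≠ 0) :
    ∃ z₀ ∈ ball (0:ℂ) 1, z₀ ≠ 0 ∧ ∃ σ : ℂ, σ ≠ 0 ∧
      ∀ a : lp (fun _ : ℕ => ℂ) 2, ν a = σ * ∑' n : ℕ, a n * z₀ ^ n := by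
  exact Stmt12.main ν h
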